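/- Let L₀, L₁ be m×m real matrices with L₀ invertible, let P(n,·), n ∈ ℕ, be a family of counting kernels for the MSP (L₀, L₁), and let μ be a Borel probability measure on [0,∞) with finite positive mean 1/λ₁. Define V_n = ∫ P(n,t) dμ(t) and Δ_n = λ₁ ∫₀^∞ P(n,t) μ((t,∞)) dt. Then for every n ≥ 1, Δ_n = (Δ_{n-1} L₁ - λ₁ V_n)(-L₀)^{-1}. -/

import Mathlib

open MeasureTheory Matrix

/-- A family of counting kernels for a Markovian service process (MSP) with representation
`(L₀, L₁)`: continuously differentiable (on `[0,∞)`) nonnegative matrix functions `P n`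
with `P 0 0 = I`, `P n 0 = 0` for `n ≥ 1`, satisfying the Kolmogorov forward equations
`(d/dt) P 0 t = P 0 t * L₀` and `(d/dt) P n t = P n t * L₀ + P (n-1) t * L₁` for `n ≥ 1`,
and total mass at most one from every initial phase. -/
structure MSPCountingKernel (m : ℕ) (L0 L1 : Matrix (Fin m) (Fin m) ℝ) where
  P : ℕ → ℝ → Matrix (Fin m) (Fin m) ℝ
  nonneg : ∀ n : ℕ, ∀ t : ℝ, 0 ≤ t → ∀ i j, 0 ≤ P n t i j
  init_zero : P 0 0 = 1
  init_pos : ∀ n : ℕ, 1 ≤ n → P n 0 = 0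
  continuousOn : ∀ n : ℕ, ∀ i j, ContinuousOn (fun t => P n t i j) (Set.Ici 0)
  hasDeriv_zero : ∀ t : ℝ, 0 ≤ t → ∀ i j,
    HasDerivWithinAt (fun s => P 0 s i j) ((P 0 t * L0) i j) (Set.Ici 0) t
  hasDeriv_pos : ∀ n : ℕ, 1 ≤ n → ∀ t : ℝ, 0 ≤ t → ∀ i j,
    HasDerivWithinAt (fun s => P n s i j)
      ((P n t * L0 + P (n - 1) t * L1) i j) (Set.Ici 0) t
  mass_summable : ∀ t : ℝ, 0 ≤ t → ∀ i, Summable (fun n : ℕ => ∑ j, P n t i j)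
  mass_le_one : ∀ t : ℝ, 0 ≤ t → ∀ i, (∑' n : ℕ, ∑ j, P n t i j) ≤ 1

theorem ae_nonneg_of_measure_Iio_eq_zero {μ : Measure ℝ} (hsupp : μ (Set.Iio 0) = 0) :
    ∀ᵐ x ∂μ, 0 ≤ x := by
  rw [ae_iff]
  simpa [Set.Iio] using hsupp

/-- Fubini for a bounded continuous function against the tail of a measure on `[0,∞)` with
finite mean. -/
theorem integrable_integral_mul_tail {μ : Measure ℝ} [IsProbabilityMeasure μ]
    (hsupp : μ (Set.Iio 0) = 0) (hint : Integrable (fun t : ℝ => t) μ)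
    {g : ℝ → ℝ} (hg : ContinuousOn g (Set.Ici 0)) {C : ℝ} (hC : ∀ t, 0 ≤ t → |g t| ≤ C) :
    Integrable (fun t => g t * (μ (Set.Ioi t)).toReal) (volume.restrict (Set.Ioi 0)) ∧
      ∫ t in Set.Ioi (0 : ℝ), g t * (μ (Set.Ioi t)).toReal =
        ∫ x, (∫ t in (0 : ℝ)..x, g t) ∂μ := by
  have hpos := ae_nonneg_of_measure_Iio_eq_zero hsupp
  have hS : MeasurableSet {p : ℝ × ℝ | p.1 < p.2} := measurableSet_lt measurable_fst measurable_snd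
  set F : ℝ × ℝ → ℝ := {p : ℝ × ℝ | p.1 < p.2}.indicator (fun p => g p.1) with hF
  have hgm : AEStronglyMeasurable g (volume.restrict (Set.Ioi 0)) :=
    (hg.mono Set.Ioi_subset_Ici_self).aestronglyMeasurable measurableSet_Ioi
  have hFm : AEStronglyMeasurable F ((volume.restrict (Set.Ioi (0 : ℝ))).prod μ) :=
    hgm.comp_fst.indicator hS
  have hsec : ∀ x, (fun t => F (t, x)) = (Set.Iio x).indicator g := by
    intro x
    ext t
    simp [hF, Set.indicator]
  have hset : ∀ x : ℝ, Set.Iio x ∩ Set.Ioi 0 = Set.Ioo 0 x := fun x => by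
    rw [Set.inter_comm, Set.Ioi_inter_Iio]
  have hgI : ∀ x : ℝ, IntegrableOn g (Set.Ioo 0 x) := fun x =>
    ((hg.mono Set.Icc_subset_Ici_self).integrableOn_Icc (a := 0) (b := x)).mono_set
      Set.Ioo_subset_Icc_self
  have hFint : Integrable F ((volume.restrict (Set.Ioi (0 : ℝ))).prod μ) := by
    refine (integrable_prod_iff' hFm).2 ⟨Filter.Eventually.of_forall fun x => ?_, ?_⟩
    · rw [hsec, integrable_indicator_iff measurableSet_Iio, IntegrableOn,
        Measure.restrict_restrict measurableSet_Iio, hset]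
      exact hgI x
    · refine (hint.const_mul C).mono' hFm.norm.prod_swap.integral_prod_right' ?_
      filter_upwards [hpos] with x hx
      have h1 : ∫ t in Set.Ioi (0 : ℝ), ‖F (t, x)‖ = ∫ t in Set.Ioo 0 x, ‖g t‖ := by
        rw [← hset, ← Measure.restrict_restrict measurableSet_Iio,
          ← integral_indicator measurableSet_Iio]
        refine integral_congr_ae (Filter.Eventually.of_forall fun t => ?_)
        simp only [← norm_indicator_eq_indicator_norm]
        rw [← hsec]
      change ‖∫ t in Set.Ioi (0 : ℝ), ‖F (t, x)‖‖ ≤ C * x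
      rw [h1]
      refine (norm_setIntegral_le_of_norm_le_const (C := C) (by simp) ?_).trans_eq ?_
      · intro t ht
        simpa using hC t ht.1.le
      · simp [Measure.real, hx]
  have hinner : ∀ t, ∫ x, F (t, x) ∂μ = g t * (μ (Set.Ioi t)).toReal := by
    intro t
    have : (fun x => F (t, x)) = (Set.Ioi t).indicator (fun _ => g t) := by
      ext x
      simp [hF, Set.indicator]
    rw [this, integral_indicator measurableSet_Ioi, setIntegral_const, smul_eq_mul, mul_comm]
    rfl
  refine ⟨by simpa only [hinner] using hFint.integral_prod_left, ?_⟩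
  simp only [← hinner]
  rw [integral_integral_swap (f := fun t x => F (t, x)) hFint]
  refine integral_congr_ae ?_
  filter_upwards [hpos] with x hx
  rw [hsec, integral_indicator measurableSet_Iio, Measure.restrict_restrict measurableSet_Iio,
    hset, intervalIntegral.integral_of_le hx, integral_Ioc_eq_integral_Ioo]

namespace MSPCountingKernel

variable {m : ℕ} {L0 L1 : Matrix (Fin m) (Fin m) ℝ}

theorem abs_le_one (K : MSPCountingKernel m L0 L1) (n : ℕ) {t : ℝ} (ht : 0 ≤ t) (i j : Fin m) :
    |K.P n t i j| ≤ 1 := by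
  rw [abs_of_nonneg (K.nonneg n t ht i j)]
  calc K.P n t i j ≤ ∑ j, K.P n t i j :=
        Finset.single_le_sum (fun k _ => K.nonneg n t ht i k) (Finset.mem_univ j)
    _ ≤ ∑' n, ∑ j, K.P n t i j := (K.mass_summable t ht i).le_tsum n fun k _ =>
        Finset.sum_nonneg fun l _ => K.nonneg k t ht i l
    _ ≤ 1 := K.mass_le_one t ht i

theorem continuousOn_mul_apply (K : MSPCountingKernel m L0 L1) (n : ℕ)
    (A : Matrix (Fin m) (Fin m) ℝ) (i j : Fin m) :
    ContinuousOn (fun t => (K.P n t * A) i j) (Set.Ici 0) := by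
  simp only [Matrix.mul_apply]
  exact continuousOn_finsetSum _ fun k _ => (K.continuousOn n i k).mul continuousOn_const

theorem abs_mul_apply_le (K : MSPCountingKernel m L0 L1) (n : ℕ)
    (A : Matrix (Fin m) (Fin m) ℝ) {t : ℝ} (ht : 0 ≤ t) (i j : Fin m) :
    |(K.P n t * A) i j| ≤ ∑ k, |A k j| := by
  rw [Matrix.mul_apply]
  refine (Finset.abs_sum_le_sum_abs _ _).trans (Finset.sum_le_sum fun k _ => ?_)
  rw [abs_mul]
  exact mul_le_of_le_one_left (abs_nonneg _) (K.abs_le_one n ht i k)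

theorem integral_mul_apply_mul_tail (K : MSPCountingKernel m L0 L1) {μ : Measure ℝ}
    [IsProbabilityMeasure μ] (hsupp : μ (Set.Iio 0) = 0) (hint : Integrable (fun t : ℝ => t) μ)
    (n : ℕ) (A : Matrix (Fin m) (Fin m) ℝ) (i j : Fin m) :
    ∫ t in Set.Ioi (0 : ℝ), (K.P n t * A) i j * (μ (Set.Ioi t)).toReal =
      ∑ k, (∫ t in Set.Ioi (0 : ℝ), K.P n t i k * (μ (Set.Ioi t)).toReal) * A k j := by
  simp only [← integral_mul_const]
  rw [← integral_finsetSum]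
  · refine integral_congr_ae (Filter.Eventually.of_forall fun t => ?_)
    simp only [Matrix.mul_apply, Finset.sum_mul]
    exact Finset.sum_congr rfl fun k _ => by ring
  · intro k _
    exact (integrable_integral_mul_tail hsupp hint (K.continuousOn n i k)
      fun t ht => K.abs_le_one n ht i k).1.mul_const _

theorem integral_deriv_mul_tail (K : MSPCountingKernel m L0 L1) {μ : Measure ℝ}
    [IsProbabilityMeasure μ] (hsupp : μ (Set.Iio 0) = 0) (hint : Integrable (fun t : ℝ => t) μ)
    {n : ℕ} (hn : 1 ≤ n) (i j : Fin m) :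
    (∫ t in Set.Ioi (0 : ℝ), (K.P n t * L0) i j * (μ (Set.Ioi t)).toReal) +
      ∫ t in Set.Ioi (0 : ℝ), (K.P (n - 1) t * L1) i j * (μ (Set.Ioi t)).toReal =
      ∫ t, K.P n t i j ∂μ := by
  have h0 := K.continuousOn_mul_apply n L0 i j
  have h1 := K.continuousOn_mul_apply (n - 1) L1 i j
  rw [← integral_add
    (integrable_integral_mul_tail hsupp hint h0 fun t ht => K.abs_mul_apply_le n L0 ht i j).1
    (integrable_integral_mul_tail hsupp hint h1 fun t ht => K.abs_mul_apply_le _ L1 ht i j).1]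
  simp only [← add_mul]
  refine (integrable_integral_mul_tail hsupp hint (h0.add h1) fun t ht => (abs_add_le _ _).trans
    (add_le_add (K.abs_mul_apply_le n L0 ht i j) (K.abs_mul_apply_le (n - 1) L1 ht i j))).2.trans ?_
  have hpos := ae_nonneg_of_measure_Iio_eq_zero hsupp
  refine integral_congr_ae ?_
  filter_upwards [hpos] with x hx
  refine (intervalIntegral.integral_eq_sub_of_hasDerivAt_of_le hx
    (f := fun s => K.P n s i j) ((K.continuousOn n i j).mono Set.Icc_subset_Ici_self)
    (fun t ht => (K.hasDeriv_pos n hn t ht.1.le i j).hasDerivAt (Ici_mem_nhds ht.1))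
    (((h0.add h1).mono Set.Icc_subset_Ici_self).intervalIntegrable_of_Icc hx)).trans ?_
  simp [K.init_pos n hn]

end MSPCountingKernel

/-- For an MSP counting kernel family with `L₀` invertible and an excess inter-arrival
distribution `μ` on `[0,∞)` with finite positive mean `1/λ₁`, the matrices
`Vₙ = ∫ P(n,t) dμ(t)` and `Δₙ = λ₁ ∫₀^∞ P(n,t) μ((t,∞)) dt` satisfy
`Δₙ = (Δₙ₋₁ L₁ - λ₁ Vₙ)(-L₀)⁻¹` for every `n ≥ 1`. -/
theorem Delta_recursion (m : ℕ) (L0 L1 : Matrix (Fin m) (Fin m) ℝ)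
    (hL0 : IsUnit L0.det) (K : MSPCountingKernel m L0 L1)
    (μ : Measure ℝ) [IsProbabilityMeasure μ] (hsupp : μ (Set.Iio 0) = 0)
    (lam1 : ℝ) (hlam : 0 < lam1) (hint : Integrable (fun t : ℝ => t) μ)
    (hmean : (∫ t, t ∂μ) = 1 / lam1)
    (V : ℕ → Matrix (Fin m) (Fin m) ℝ)
    (hV : ∀ n : ℕ, V n = Matrix.of fun i j => ∫ t, K.P n t i j ∂μ)
    (Δ : ℕ → Matrix (Fin m) (Fin m) ℝ)
    (hΔ : ∀ n : ℕ, Δ n = Matrix.of fun i j =>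
      lam1 * ∫ t in Set.Ioi (0 : ℝ), K.P n t i j * (μ (Set.Ioi t)).toReal) :
    ∀ n : ℕ, 1 ≤ n → Δ n = (Δ (n - 1) * L1 - lam1 • V n) * (-L0)⁻¹ := by
  intro n hn
  have key : Δ n * L0 + Δ (n - 1) * L1 = lam1 • V n := by
    ext i j
    have h := K.integral_deriv_mul_tail hsupp hint hn i j
    rw [K.integral_mul_apply_mul_tail hsupp hint, K.integral_mul_apply_mul_tail hsupp hint] at h
    simp only [hΔ, hV, Matrix.add_apply, Matrix.mul_apply, Matrix.smul_apply, Matrix.of_apply,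
      smul_eq_mul, ← h, mul_add, Finset.mul_sum, mul_assoc]
  have hdet : IsUnit (-L0).det := by
    rw [← Matrix.isUnit_iff_isUnit_det] at hL0 ⊢
    exact hL0.neg
  rw [← key, sub_add_cancel_right, ← mul_neg, Matrix.mul_assoc, Matrix.mul_nonsing_inv _ hdet,
    Matrix.mul_one]
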